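/- arXiv:1506.07300 — 2 statements merged into one kernel-verified Lean document; each statement's English description precedes it below -/
import Mathlib

section
/- Let U ∈ ℝ^{p×q} and let {H_1,…,H_K} be a partition of the index set {1,…,p}×{1,…,q}, and let s_1,…,s_K be positive integers. For each i, let I_i ⊆ H_i be a set of min(s_i, |H_i|) indices on which |U| is largest within H_i (i.e., |I_i| = min(s_i,|H_i|) and every entry of U indexed by I_i has absolute value at least as large as every entry of U indexed by H_i ∖ I_i), and set I = ∪_{i=1}^K I_i. Assume U_I ≠ 0. Then the matrix S* = U_I / ‖U_I‖_F belongs to the constraint set E = {S ∈ ℝ^{p×q} : ‖S_{H_i}‖_0 ≤ s_i for all i ∈ {1,…,K}, ‖S‖_F = 1}, and for every S ∈ E one has ‖S* − U‖_F ≤ ‖S − U‖_F; that is, S* is a projection of U onto E. -/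
noncomputable def frobNorm {p q : ℕ} (A : Matrix (Fin p) (Fin q) ℝ) : ℝ :=
  Real.sqrt (∑ i, ∑ j, A i j ^ 2)

noncomputable def restrict {p q : ℕ} (A : Matrix (Fin p) (Fin q) ℝ)
    (T : Finset (Fin p × Fin q)) : Matrix (Fin p) (Fin q) ℝ :=
  Matrix.of fun i j => if (i, j) ∈ T then A i j else 0

open Classical in
noncomputable def l0 {p q : ℕ} (A : Matrix (Fin p) (Fin q) ℝ) : ℕ :=
  (Finset.univ.filter fun ij : Fin p × Fin q => A ij.1 ij.2 ≠ 0).card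

open Finset in
/-- A set of at most as many elements of `H` as `I` has carries a smaller sum than `I`, when the
values of the nonnegative function `f` on `I` dominate those on `H \ I`. -/
theorem sum_le_sum_of_card_le_of_dominates {α : Type*} [DecidableEq α] {f : α → ℝ}
    (hf : ∀ a, 0 ≤ f a) {H I J : Finset α} (hJ : J ⊆ H) (hcard : J.card ≤ I.card)
    (hmax : ∀ a ∈ I, ∀ b ∈ H \ I, f b ≤ f a) : ∑ x ∈ J, f x ≤ ∑ x ∈ I, f x := by
  have hsdiff : (J \ I).card ≤ (I \ J).card := by
    have h₁ := card_sdiff_add_card_inter J I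
    have h₂ := card_sdiff_add_card_inter I J
    rw [inter_comm] at h₂
    omega
  have key : ∑ x ∈ J \ I, f x ≤ ∑ x ∈ I \ J, f x := by
    rcases (J \ I).eq_empty_or_nonempty with h | h
    · rw [h, sum_empty]
      exact sum_nonneg fun a _ => hf a
    · obtain ⟨b, hb, hbmax⟩ := exists_max_image (J \ I) f h
      calc ∑ x ∈ J \ I, f x ≤ (J \ I).card • f b := sum_le_card_nsmul _ _ _ hbmax
        _ ≤ (I \ J).card • f b := nsmul_le_nsmul_left (hf b) hsdiff
        _ ≤ ∑ x ∈ I \ J, f x := card_nsmul_le_sum _ _ _ fun a ha =>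
            hmax a (mem_sdiff.1 ha).1 b (sdiff_subset_sdiff hJ subset_rfl hb)
  have h₁ := sum_inter_add_sum_sdiff J I f
  have h₂ := sum_inter_add_sum_sdiff I J f
  rw [inter_comm] at h₂
  linarith

theorem frobNorm_sq {p q : ℕ} (A : Matrix (Fin p) (Fin q) ℝ) :
    frobNorm A ^ 2 = ∑ x : Fin p × Fin q, A x.1 x.2 ^ 2 := by
  rw [frobNorm, Real.sq_sqrt (by positivity), Fintype.sum_prod_type]

theorem frobNorm_nonneg {p q : ℕ} (A : Matrix (Fin p) (Fin q) ℝ) : 0 ≤ frobNorm A :=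
  Real.sqrt_nonneg _

theorem frobNorm_pos {p q : ℕ} {A : Matrix (Fin p) (Fin q) ℝ} (hA : A ≠ 0) : 0 < frobNorm A := by
  refine (frobNorm_nonneg A).lt_of_ne' fun h => hA ?_
  have hsq := frobNorm_sq A
  rw [h, zero_pow two_ne_zero, eq_comm,
    Finset.sum_eq_zero_iff_of_nonneg fun _ _ => sq_nonneg _] at hsq
  ext i j
  exact pow_eq_zero_iff two_ne_zero |>.1 (hsq (i, j) (Finset.mem_univ _))

theorem frobNorm_smul {p q : ℕ} {c : ℝ} (hc : 0 ≤ c) (A : Matrix (Fin p) (Fin q) ℝ) :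
    frobNorm (c • A) = c * frobNorm A := by
  rw [← sq_eq_sq₀ (frobNorm_nonneg _) (mul_nonneg hc (frobNorm_nonneg _)), mul_pow,
    frobNorm_sq, frobNorm_sq, Finset.mul_sum]
  simp [mul_pow]

theorem frobNorm_sub_sq {p q : ℕ} (A B : Matrix (Fin p) (Fin q) ℝ) :
    frobNorm (A - B) ^ 2 =
      frobNorm A ^ 2 - 2 * ∑ x : Fin p × Fin q, A x.1 x.2 * B x.1 x.2 + frobNorm B ^ 2 := by
  simp only [frobNorm_sq, Matrix.sub_apply, Finset.mul_sum, ← Finset.sum_sub_distrib,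
    ← Finset.sum_add_distrib]
  exact Finset.sum_congr rfl fun _ _ => by ring

theorem frobNorm_restrict_sq {p q : ℕ} (A : Matrix (Fin p) (Fin q) ℝ)
    (T : Finset (Fin p × Fin q)) :
    frobNorm (restrict A T) ^ 2 = ∑ x ∈ T, A x.1 x.2 ^ 2 := by
  simp [frobNorm_sq, restrict, ite_pow]

theorem sum_restrict_mul {p q : ℕ} (A : Matrix (Fin p) (Fin q) ℝ)
    (T : Finset (Fin p × Fin q)) :
    ∑ x : Fin p × Fin q, restrict A T x.1 x.2 * A x.1 x.2 = frobNorm (restrict A T) ^ 2 := by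
  rw [frobNorm_restrict_sq]
  simp [restrict, ite_mul, sq]

/-- Cauchy–Schwarz, restricted to a set that contains the support of the first factor. -/
theorem sum_mul_le_frobNorm_mul_frobNorm_restrict {p q : ℕ} (S U : Matrix (Fin p) (Fin q) ℝ)
    {T : Finset (Fin p × Fin q)} (hT : ∀ x, S x.1 x.2 ≠ 0 → x ∈ T) :
    ∑ x : Fin p × Fin q, S x.1 x.2 * U x.1 x.2 ≤ frobNorm S * frobNorm (restrict U T) := by
  have h : ∑ x : Fin p × Fin q, S x.1 x.2 * U x.1 x.2 =
      ∑ x : Fin p × Fin q, S x.1 x.2 * restrict U T x.1 x.2 := by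
    refine Finset.sum_congr rfl fun x _ => ?_
    by_cases hx : S x.1 x.2 = 0
    · simp [hx]
    · simp [restrict, hT x hx]
  rw [h]
  refine abs_le_of_sq_le_sq' ?_ (mul_nonneg (frobNorm_nonneg _) (frobNorm_nonneg _)) |>.2
  rw [mul_pow, frobNorm_sq, frobNorm_sq]
  exact Finset.sum_mul_sq_le_sq_mul_sq _ _ _

theorem l0_restrict {p q : ℕ} (A : Matrix (Fin p) (Fin q) ℝ) (T : Finset (Fin p × Fin q)) :
    l0 (restrict A T) = {x ∈ T | A x.1 x.2 ≠ 0}.card := by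
  classical
  unfold l0
  congr 1
  ext x
  simp [restrict]

theorem sum_eq_sum_sum_inter {α ι M : Type*} [DecidableEq α] [Fintype ι] [AddCommMonoid M]
    {H : ι → Finset α} (hH : ∀ a, ∃! i, a ∈ H i) (T : Finset α) (f : α → M) :
    ∑ x ∈ T, f x = ∑ i, ∑ x ∈ T ∩ H i, f x := by
  rw [← Finset.sum_biUnion]
  · congr 1
    ext x
    simpa using fun _ => (hH x).exists
  · intro i _ j _ hij
    rw [Function.onFun, Finset.disjoint_left]
    intro x hx hx'
    exact hij ((hH x).unique (Finset.mem_inter.1 hx).2 (Finset.mem_inter.1 hx').2)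

/-- Projection onto the set of unit Frobenius norm matrices with at most `s i`
nonzero entries within each cell `H i` of a partition of the index set:
it is obtained by keeping, within each cell, the `min (s i) |H i|` largest-magnitude entries
of `U`, zeroing all others, and normalizing. -/
theorem projection_structured_sparsity
    {p q K : ℕ} (U : Matrix (Fin p) (Fin q) ℝ)
    (H : Fin K → Finset (Fin p × Fin q))
    (hpart : ∀ ij : Fin p × Fin q, ∃! i : Fin K, ij ∈ H i)
    (s : Fin K → ℕ) (hs : ∀ i, 0 < s i)
    (I : Fin K → Finset (Fin p × Fin q))
    (hIsub : ∀ i, I i ⊆ H i)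
    (hIcard : ∀ i, (I i).card = min (s i) (H i).card)
    (hImax : ∀ i, ∀ a ∈ I i, ∀ b ∈ H i \ I i, |U b.1 b.2| ≤ |U a.1 a.2|)
    (Itot : Finset (Fin p × Fin q)) (hItot : Itot = Finset.univ.biUnion I)
    (hne : restrict U Itot ≠ 0)
    (Sstar : Matrix (Fin p) (Fin q) ℝ)
    (hSstar : Sstar = (frobNorm (restrict U Itot))⁻¹ • restrict U Itot) :
    (∀ i, l0 (restrict Sstar (H i)) ≤ s i) ∧ frobNorm Sstar = 1 ∧
      ∀ S : Matrix (Fin p) (Fin q) ℝ,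
        (∀ i, l0 (restrict S (H i)) ≤ s i) → frobNorm S = 1 →
        frobNorm (Sstar - U) ≤ frobNorm (S - U) := by
  have hinter : ∀ i, Itot ∩ H i = I i := by
    intro i
    ext x
    simp only [hItot, Finset.mem_inter, Finset.mem_biUnion, Finset.mem_univ, true_and]
    constructor
    · rintro ⟨⟨j, hj⟩, hx⟩
      rwa [(hpart x).unique hx (hIsub j hj)]
    · exact fun hx => ⟨⟨i, hx⟩, hIsub i hx⟩
  set N := frobNorm (restrict U Itot) with hN
  have hNpos : 0 < N := frobNorm_pos hne
  have hnorm : frobNorm Sstar = 1 := by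
    rw [hSstar, frobNorm_smul (inv_nonneg.2 hNpos.le), ← hN, inv_mul_cancel₀ hNpos.ne']
  have hinner : ∑ x : Fin p × Fin q, Sstar x.1 x.2 * U x.1 x.2 = N := by
    simp only [hSstar, Matrix.smul_apply, smul_eq_mul, mul_assoc, ← Finset.mul_sum,
      sum_restrict_mul, ← hN]
    field_simp
  refine ⟨fun i => ?_, hnorm, fun S hS hSnorm => ?_⟩
  · rw [l0_restrict]
    refine (Finset.card_le_card (t := I i) fun x hx => ?_).trans
      ((hIcard i).trans_le (min_le_left _ _))
    rw [Finset.mem_filter] at hx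
    rw [← hinter i, Finset.mem_inter]
    refine ⟨?_, hx.1⟩
    by_contra hxI
    exact hx.2 (by simp [hSstar, restrict, hxI])
  · set T : Finset (Fin p × Fin q) := {x | S x.1 x.2 ≠ 0} with hT
    have hTN : frobNorm (restrict U T) ≤ N := by
      rw [← sq_le_sq₀ (frobNorm_nonneg _) hNpos.le, hN, frobNorm_restrict_sq,
        frobNorm_restrict_sq, sum_eq_sum_sum_inter hpart T, sum_eq_sum_sum_inter hpart Itot]
      refine Finset.sum_le_sum fun i _ => ?_
      rw [hinter i]
      refine sum_le_sum_of_card_le_of_dominates (fun _ => sq_nonneg _)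
        Finset.inter_subset_right ?_ fun a ha b hb => sq_le_sq.2 (hImax i a ha b hb)
      rw [hIcard i]
      refine le_min ?_ (Finset.card_le_card Finset.inter_subset_right)
      refine le_trans (Finset.card_le_card fun x hx => ?_)
        ((l0_restrict S (H i)).symm.trans_le (hS i))
      simpa [hT, and_comm] using hx
    have hSU := sum_mul_le_frobNorm_mul_frobNorm_restrict S U (T := T) fun x hx => by
      simpa [hT] using hx
    rw [hSnorm, one_mul] at hSU
    rw [← sq_le_sq₀ (frobNorm_nonneg _) (frobNorm_nonneg _), frobNorm_sub_sq, frobNorm_sub_sq,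
      hnorm, hSnorm, hinner]
    linarith
end

section
/- Let C_1,…,C_K be nonempty pairwise disjoint subsets of the index set {1,…,p}×{1,…,q}, let 1 ≤ s ≤ K, and define E_c as the set of matrices S ∈ ℝ^{p×q} with ‖S‖_F = 1 for which there exists a vector ã = (ã_1,…,ã_K) with ‖ã‖_0 ≤ s such that S is constant equal to ã_i on each C_i and zero outside ∪_i C_i. Given U ∈ ℝ^{p×q}, define ũ_i = Σ_{(m,n)∈C_i} U_{mn}. Let J̃ ⊆ {1,…,K} with |J̃| = s be a set of indices on which |ũ_i|/√|C_i| is largest (i.e., for every i ∈ J̃ and j ∉ J̃, |ũ_i|/√|C_i| ≥ |ũ_j|/√|C_j|), and assume ũ_i ≠ 0 for some i ∈ J̃. Then the matrix S* ∈ E_c defined by taking ã_i = (ũ_i/|C_i|)/Z for i ∈ J̃, where Z = √(Σ_{i∈J̃} ũ_i²/|C_i|), and ã_i = 0 for i ∉ J̃, satisfies ‖S* − U‖_F ≤ ‖S − U‖_F for every S ∈ E_c; that is, S* is a projection of U onto E_c. -/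
open Classical in
/-- number of non-zero coordinates of a vector -/
noncomputable def vecL0 {K : ℕ} (a : Fin K → ℝ) : ℕ :=
  (Finset.univ.filter fun i : Fin K => a i ≠ 0).card

/-- Membership in the constraint set `E_c` of unit-Frobenius-norm matrices that are
constant equal to `ã i` on each `C i` (with `‖ã‖₀ ≤ s`) and zero outside `∪ i, C i`. -/
def memEc {p q K : ℕ} (C : Fin K → Finset (Fin p × Fin q)) (s : ℕ)
    (S : Matrix (Fin p) (Fin q) ℝ) : Prop :=
  frobNorm S = 1 ∧
    ∃ a : Fin K → ℝ, vecL0 a ≤ s ∧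
      (∀ i : Fin K, ∀ mn ∈ C i, S mn.1 mn.2 = a i) ∧
      (∀ mn : Fin p × Fin q, (∀ i : Fin K, mn ∉ C i) → S mn.1 mn.2 = 0)

/-- A nonnegative weight sums to at least as much over a top-valued set as over any set of
no larger cardinality. -/
lemma sum_le_sum_of_card_le_of_top {ι : Type*} [DecidableEq ι] {J T : Finset ι} {w : ι → ℝ}
    (hw : ∀ i, 0 ≤ w i) (hcard : J.card ≤ T.card) (htop : ∀ i ∈ T, ∀ j ∉ T, w j ≤ w i) :
    ∑ i ∈ J, w i ≤ ∑ i ∈ T, w i := by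
  have hc : (J \ T).card ≤ (T \ J).card := by
    have h1 := Finset.card_sdiff_add_card_inter J T
    have h2 := Finset.card_sdiff_add_card_inter T J
    rw [Finset.inter_comm] at h2
    omega
  have key : ∑ i ∈ J \ T, w i ≤ ∑ i ∈ T \ J, w i := by
    rcases (T \ J).eq_empty_or_nonempty with he | hne
    · rw [he, Finset.card_empty, Nat.le_zero, Finset.card_eq_zero] at hc
      simp [he, hc]
    · obtain ⟨k, hk, hmin⟩ := Finset.exists_min_image _ w hne
      calc ∑ i ∈ J \ T, w i ≤ (J \ T).card • w k :=
            Finset.sum_le_card_nsmul _ _ _ fun j hj =>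
              htop k (Finset.mem_sdiff.1 hk).1 j (Finset.mem_sdiff.1 hj).2
        _ ≤ (T \ J).card • w k := nsmul_le_nsmul_left (hw k) hc
        _ ≤ ∑ i ∈ T \ J, w i := Finset.card_nsmul_le_sum _ _ _ hmin
  have h1 := Finset.sum_inter_add_sum_sdiff J T w
  have h2 := Finset.sum_inter_add_sum_sdiff T J w
  rw [Finset.inter_comm] at h2
  linarith

/-- The entrywise inner product of a piecewise-constant matrix with an arbitrary matrix. -/
lemma sum_mul_of_piecewise_constant {p q K : ℕ} {C : Fin K → Finset (Fin p × Fin q)}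
    (hC : ∀ i j : Fin K, i ≠ j → Disjoint (C i) (C j))
    {S : Matrix (Fin p) (Fin q) ℝ} {a : Fin K → ℝ}
    (hS : ∀ i : Fin K, ∀ mn ∈ C i, S mn.1 mn.2 = a i)
    (hS0 : ∀ mn : Fin p × Fin q, (∀ i : Fin K, mn ∉ C i) → S mn.1 mn.2 = 0)
    (U : Matrix (Fin p) (Fin q) ℝ) :
    ∑ m, ∑ n, S m n * U m n = ∑ i, a i * ∑ mn ∈ C i, U mn.1 mn.2 := by
  have h1 : ∑ m, ∑ n, S m n * U m n =
      ∑ mn ∈ Finset.univ.biUnion C, S mn.1 mn.2 * U mn.1 mn.2 := by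
    rw [← Fintype.sum_prod_type' fun m n => S m n * U m n]
    refine (Finset.sum_subset (Finset.subset_univ _) fun mn _ hmn => ?_).symm
    rw [hS0 mn (by simpa using hmn), zero_mul]
  rw [h1, Finset.sum_biUnion fun i _ j _ hij => hC i j hij]
  refine Finset.sum_congr rfl fun i _ => ?_
  rw [Finset.mul_sum]
  exact Finset.sum_congr rfl fun mn hmn => by rw [hS i mn hmn]

/-- The sum of squares of the entries of a piecewise-constant matrix. -/
lemma sum_sq_of_piecewise_constant {p q K : ℕ} {C : Fin K → Finset (Fin p × Fin q)}
    (hC : ∀ i j : Fin K, i ≠ j → Disjoint (C i) (C j))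
    {S : Matrix (Fin p) (Fin q) ℝ} {a : Fin K → ℝ}
    (hS : ∀ i : Fin K, ∀ mn ∈ C i, S mn.1 mn.2 = a i)
    (hS0 : ∀ mn : Fin p × Fin q, (∀ i : Fin K, mn ∉ C i) → S mn.1 mn.2 = 0) :
    ∑ m, ∑ n, S m n ^ 2 = ∑ i, ((C i).card : ℝ) * a i ^ 2 := by
  simp_rw [sq]
  rw [sum_mul_of_piecewise_constant hC hS hS0]
  refine Finset.sum_congr rfl fun i _ => ?_
  rw [Finset.sum_congr rfl (hS i), Finset.sum_const, nsmul_eq_mul]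
  ring

/-- Among unit-norm matrices, a larger inner product with `U` means a smaller distance to `U`. -/
lemma frobNorm_sub_le_of_inner_le {p q : ℕ} {S T U : Matrix (Fin p) (Fin q) ℝ}
    (hS : frobNorm S = 1) (hT : frobNorm T = 1)
    (h : ∑ m, ∑ n, S m n * U m n ≤ ∑ m, ∑ n, T m n * U m n) :
    frobNorm (T - U) ≤ frobNorm (S - U) := by
  have expand (A : Matrix (Fin p) (Fin q) ℝ) : ∑ m, ∑ n, (A - U) m n ^ 2 =
      ∑ m, ∑ n, A m n ^ 2 - 2 * ∑ m, ∑ n, A m n * U m n + ∑ m, ∑ n, U m n ^ 2 := by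
    simp only [Finset.mul_sum, ← Finset.sum_sub_distrib, ← Finset.sum_add_distrib]
    refine Finset.sum_congr rfl fun m _ => Finset.sum_congr rfl fun n _ => ?_
    rw [Matrix.sub_apply]
    ring
  refine Real.sqrt_le_sqrt ?_
  rw [expand, expand, Real.sqrt_eq_one.1 hS, Real.sqrt_eq_one.1 hT]
  linarith

/-- Projection onto the set of sparse piecewise-constant unit-norm matrices. -/
theorem projection_sparse_piecewise_constant
    {p q K : ℕ} (C : Fin K → Finset (Fin p × Fin q))
    (hCne : ∀ i, (C i).Nonempty)
    (hCdisj : ∀ i j : Fin K, i ≠ j → Disjoint (C i) (C j))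
    (s : ℕ) (hs1 : 1 ≤ s) (hsK : s ≤ K)
    (U : Matrix (Fin p) (Fin q) ℝ)
    (ut : Fin K → ℝ) (hut : ∀ i, ut i = ∑ mn ∈ C i, U mn.1 mn.2)
    (Jt : Finset (Fin K)) (hJtcard : Jt.card = s)
    (hJtmax : ∀ i ∈ Jt, ∀ j ∉ Jt,
      |ut j| / Real.sqrt ((C j).card) ≤ |ut i| / Real.sqrt ((C i).card))
    (hnz : ∃ i ∈ Jt, ut i ≠ 0)
    (Z : ℝ) (hZ : Z = Real.sqrt (∑ i ∈ Jt, ut i ^ 2 / ((C i).card : ℝ)))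
    (Sstar : Matrix (Fin p) (Fin q) ℝ)
    (hSstar : Sstar = Matrix.of fun m n =>
      ∑ i ∈ Jt, if (m, n) ∈ C i then (ut i / ((C i).card : ℝ)) / Z else 0) :
    memEc C s Sstar ∧
      ∀ S : Matrix (Fin p) (Fin q) ℝ, memEc C s S →
        frobNorm (Sstar - U) ≤ frobNorm (S - U) := by
  classical
  have hcpos (i : Fin K) : (0 : ℝ) < (C i).card := by exact_mod_cast (hCne i).card_pos
  have hw (i : Fin K) : 0 ≤ ut i ^ 2 / ((C i).card : ℝ) :=
    div_nonneg (sq_nonneg _) (hcpos i).le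
  have hpos : 0 < ∑ i ∈ Jt, ut i ^ 2 / ((C i).card : ℝ) := by
    obtain ⟨i, hi, hne⟩ := hnz
    exact Finset.sum_pos' (fun i _ => hw i)
      ⟨i, hi, div_pos (sq_pos_of_ne_zero hne) (hcpos i)⟩
  have hZpos : 0 < Z := hZ ▸ Real.sqrt_pos.2 hpos
  have hZsq : Z ^ 2 = ∑ i ∈ Jt, ut i ^ 2 / ((C i).card : ℝ) := by
    rw [hZ, Real.sq_sqrt hpos.le]
  set b : Fin K → ℝ := fun i => if i ∈ Jt then ut i / ((C i).card : ℝ) / Z else 0 with hb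
  have hconst : ∀ i : Fin K, ∀ mn ∈ C i, Sstar mn.1 mn.2 = b i := by
    intro i mn hmn
    have hmem (j : Fin K) : mn ∈ C j ↔ i = j :=
      ⟨fun hj => by_contra fun hij => Finset.disjoint_left.1 (hCdisj i j hij) hmn hj,
        fun hij => hij ▸ hmn⟩
    simp [hSstar, hmem, hb]
  have hzero : ∀ mn : Fin p × Fin q, (∀ i : Fin K, mn ∉ C i) → Sstar mn.1 mn.2 = 0 := by
    intro mn hmn
    simp [hSstar, hmn]
  have hnorm : frobNorm Sstar = 1 := by
    rw [frobNorm, Real.sqrt_eq_one, sum_sq_of_piecewise_constant hCdisj hconst hzero]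
    calc ∑ i, ((C i).card : ℝ) * b i ^ 2
        = ∑ i ∈ Jt, ut i ^ 2 / ((C i).card : ℝ) / Z ^ 2 := by
          rw [← Finset.sum_subset (Finset.subset_univ Jt) fun i _ hi => by simp [hb, hi]]
          refine Finset.sum_congr rfl fun i hi => ?_
          have := (hcpos i).ne'
          simp only [hb, hi, if_true]
          field_simp
      _ = 1 := by rw [← Finset.sum_div, ← hZsq, div_self (pow_pos hZpos 2).ne']
  have hinner : ∑ m, ∑ n, Sstar m n * U m n = Z := by
    rw [sum_mul_of_piecewise_constant hCdisj hconst hzero]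
    calc ∑ i, b i * ∑ mn ∈ C i, U mn.1 mn.2
        = ∑ i ∈ Jt, ut i ^ 2 / ((C i).card : ℝ) / Z := by
          rw [← Finset.sum_subset (Finset.subset_univ Jt) fun i _ hi => by simp [hb, hi]]
          refine Finset.sum_congr rfl fun i hi => ?_
          simp only [hb, hi, if_true, ← hut]
          ring
      _ = Z := by rw [← Finset.sum_div, ← hZsq, sq, mul_div_cancel_right₀ _ hZpos.ne']
  have hsupp : vecL0 b ≤ s := by
    rw [vecL0, ← hJtcard]
    refine Finset.card_le_card fun i hi => ?_
    by_contra h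
    simp [hb, h] at hi
  refine ⟨⟨hnorm, b, hsupp, hconst, hzero⟩, ?_⟩
  rintro S ⟨hS1, a, ha, hSc, hS0⟩
  refine frobNorm_sub_le_of_inner_le hS1 hnorm ?_
  rw [hinner, sum_mul_of_piecewise_constant hCdisj hSc hS0]
  have hsq := Real.sqrt_eq_one.1 hS1
  rw [sum_sq_of_piecewise_constant hCdisj hSc hS0] at hsq
  set J : Finset (Fin K) := Finset.univ.filter fun i => a i ≠ 0 with hJ
  have haJ (i : Fin K) (hi : i ∉ J) : a i = 0 := by simpa [hJ] using hi
  have hJcard : J.card ≤ Jt.card := by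
    rw [hJtcard, hJ]
    unfold vecL0 at ha
    convert ha
  simp_rw [← hut]
  rw [← Finset.sum_subset (Finset.subset_univ J) fun i _ hi => by simp [haJ i hi]] at hsq ⊢
  refine abs_le_of_sq_le_sq' ?_ hZpos.le |>.2
  calc (∑ i ∈ J, a i * ut i) ^ 2
      ≤ (∑ i ∈ J, ((C i).card : ℝ) * a i ^ 2) * ∑ i ∈ J, ut i ^ 2 / ((C i).card : ℝ) := by
        refine Finset.sum_sq_le_sum_mul_sum_of_sq_le_mul _
          (fun i _ => mul_nonneg (hcpos i).le (sq_nonneg _)) (fun i _ => hw i) fun i _ => ?_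
        have := (hcpos i).ne'
        refine le_of_eq ?_
        field_simp
    _ = ∑ i ∈ J, ut i ^ 2 / ((C i).card : ℝ) := by rw [hsq, one_mul]
    _ ≤ ∑ i ∈ Jt, ut i ^ 2 / ((C i).card : ℝ) := by
        refine sum_le_sum_of_card_le_of_top hw hJcard fun i hi j hj => ?_
        have h := pow_le_pow_left₀ (by positivity) (hJtmax i hi j hj) 2
        simpa [div_pow, Real.sq_sqrt] using h
    _ = Z ^ 2 := hZsq.symm
end
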